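/- Let K ∈ ℕ and let (u_j, v_j) ∈ ℝ², j ∈ Fin K, be spatial-frequency pairs such that for all j ≠ j', exp(I·u_j) ≠ exp(I·u_{j'}) or exp(I·v_j) ≠ exp(I·v_{j'}). For M₁, M₂ ∈ ℕ define the K×K Gram matrix G(M₁,M₂) with entries G(M₁,M₂)_{j,j'} = (1/(M₁·M₂))·⟨e_{M₁,M₂}(u_j,v_j), e_{M₁,M₂}(u_{j'},v_{j'})⟩. Then G(M₁,M₂) converges entrywise to the K×K identity matrix as (M₁,M₂) → ∞ along the product filter atTop ×ˢ atTop. (The normalized array response vectors of distinct paths/users—exact or perturbed by DoA estimation errors—become orthonormal asymptotically; this is the operational form of the paper's Lemmas 3 and 6 used to show that eigen-beamforming in the DoA directions nullifies intra-cell interference in the large-antenna regime.) -/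

import Mathlib

open Filter

/-- The Hermitian inner product `⟨e_{M₁,M₂}(u,v), e_{M₁,M₂}(u',v')⟩` of two 2D array
response vectors, whose entries are `exp(I(k·u + l·v))` for `0 ≤ k < M₁`, `0 ≤ l < M₂`. -/
noncomputable def arrayInner (M₁ M₂ : ℕ) (u v u' v' : ℝ) : ℂ :=
  ∑ k ∈ Finset.range M₁, ∑ l ∈ Finset.range M₂,
    (starRingEnd ℂ) (Complex.exp (Complex.I * ((k : ℂ) * (u : ℂ) + (l : ℂ) * (v : ℂ)))) *
      Complex.exp (Complex.I * ((k : ℂ) * (u' : ℂ) + (l : ℂ) * (v' : ℂ)))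

lemma aux_avg (z : ℂ) (hz : ‖z‖ = 1) :
    Tendsto (fun M : ℕ => (1 / (M : ℂ)) * ∑ k ∈ Finset.range M, z ^ k) atTop
      (nhds (if z = 1 then 1 else 0)) := by
  split_ifs with h1
  · subst h1
    refine tendsto_const_nhds.congr' ?_
    filter_upwards [eventually_gt_atTop 0] with M hM
    have : (M : ℂ) ≠ 0 := by exact_mod_cast hM.ne'
    simp [this]
  · rw [tendsto_zero_iff_norm_tendsto_zero]
    have hz1 : 0 < ‖z - 1‖ := norm_pos_iff.mpr (sub_ne_zero.mpr h1)
    refine squeeze_zero (g := fun M : ℕ => (2 / ‖z - 1‖) / (M : ℝ)) (fun _ => norm_nonneg _) ?_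
      (tendsto_const_div_atTop_nhds_zero_nat _)
    intro M
    rw [geom_sum_eq h1, norm_mul, norm_div, norm_div, norm_one, Complex.norm_natCast,
      one_div, mul_comm, ← div_eq_mul_inv]
    gcongr
    calc ‖z ^ M - 1‖ ≤ ‖z ^ M‖ + ‖(1 : ℂ)‖ := norm_sub_le _ _
      _ = 2 := by rw [norm_pow, hz]; norm_num

lemma aux_inner (M N : ℕ) (u v u' v' : ℝ) :
    arrayInner M N u v u' v' =
      (∑ k ∈ Finset.range M, Complex.exp (Complex.I * ((u' : ℂ) - u)) ^ k) *
      (∑ l ∈ Finset.range N, Complex.exp (Complex.I * ((v' : ℂ) - v)) ^ l) := by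
  unfold arrayInner
  rw [Finset.sum_mul_sum]
  refine Finset.sum_congr rfl fun k _ => Finset.sum_congr rfl fun l _ => ?_
  rw [← Complex.exp_conj, ← Complex.exp_add, ← Complex.exp_nat_mul, ← Complex.exp_nat_mul,
    ← Complex.exp_add]
  congr 1
  simp only [map_mul, map_add, Complex.conj_I, Complex.conj_ofReal, map_natCast]
  ring

lemma aux_norm (a b : ℝ) : ‖Complex.exp (Complex.I * ((b : ℂ) - a))‖ = 1 := by
  have := Complex.norm_exp_I_mul_ofReal (b - a)
  simpa using this

lemma aux_eq (a b : ℝ) : Complex.exp (Complex.I * ((b : ℂ) - a)) = 1 ↔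
    Complex.exp (Complex.I * (a : ℂ)) = Complex.exp (Complex.I * (b : ℂ)) := by
  rw [mul_sub, Complex.exp_sub, div_eq_one_iff_eq (Complex.exp_ne_zero _), eq_comm]

/-- Operational form of the paper's Lemmas 3 and 6: for `K` spatial-frequency pairs that
are pairwise distinct (mod 2π) in at least one coordinate, the `K×K` Gram matrix of
normalized array response vectors converges entrywise to the identity as the array
dimensions grow along `atTop ×ˢ atTop`. -/
theorem gram_matrix_tendsto_identity (K : ℕ) (u v : Fin K → ℝ)
    (h : ∀ j j' : Fin K, j ≠ j' →
      Complex.exp (Complex.I * (u j : ℂ)) ≠ Complex.exp (Complex.I * (u j' : ℂ)) ∨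
      Complex.exp (Complex.I * (v j : ℂ)) ≠ Complex.exp (Complex.I * (v j' : ℂ))) :
    ∀ j j' : Fin K,
      Tendsto (fun p : ℕ × ℕ =>
          (1 / ((p.1 : ℂ) * (p.2 : ℂ))) * arrayInner p.1 p.2 (u j) (v j) (u j') (v j'))
        (atTop ×ˢ atTop) (nhds ((1 : Matrix (Fin K) (Fin K) ℂ) j j')) := by
  intro j j'
  have hu := (aux_avg _ (aux_norm (u j) (u j'))).comp
    (tendsto_fst (f := (atTop : Filter ℕ)) (g := (atTop : Filter ℕ)))
  have hv := (aux_avg _ (aux_norm (v j) (v j'))).comp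
    (tendsto_snd (f := (atTop : Filter ℕ)) (g := (atTop : Filter ℕ)))
  have key := hu.mul hv
  simp only [aux_eq] at key
  have hlim : (1 : Matrix (Fin K) (Fin K) ℂ) j j' =
      (if Complex.exp (Complex.I * (u j : ℂ)) = Complex.exp (Complex.I * (u j' : ℂ))
        then (1 : ℂ) else 0) *
      (if Complex.exp (Complex.I * (v j : ℂ)) = Complex.exp (Complex.I * (v j' : ℂ))
        then (1 : ℂ) else 0) := by
    by_cases hj : j = j'
    · subst hj; simp
    · rw [Matrix.one_apply_ne hj]
      rcases h j j' hj with h1 | h1 <;> simp [h1]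
  rw [hlim]
  refine key.congr fun p => ?_
  simp only [Function.comp, aux_inner]
  rw [one_div, one_div, one_div, mul_inv]
  ring
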